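/- Let A be a Frobenius algebra with the operators ∂ (Hochschild coboundary) and Δ (the Connes-type operator on normalized cochains defined via η(a₀,(Δf)(a₁,…,a_{n−1})) = η(1, f∘N(a₀,…,a_{n−1})) with N the signed norm operator). Then Δ∂ + ∂Δ = 0 on normalized Hochschild cochains. -/

import Mathlib

/-- The Hochschild coboundary `∂ : CH^n(A,A) → CH^{n+1}(A,A)` (arguments 0-indexed). -/
def hochschildD {A : Type*} [Ring A] (n : ℕ) (f : (Fin n → A) → A) :
    (Fin (n + 1) → A) → A :=
  fun a =>
    a 0 * f (fun i => a i.succ)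
      + (∑ i : Fin n, ((-1 : ℤ) ^ ((i : ℕ) + 1)) •
          f (fun j : Fin n =>
            if (j : ℕ) < (i : ℕ) then a j.castSucc
            else if (j : ℕ) = (i : ℕ) then a j.castSucc * a j.succ
            else a j.succ))
      + ((-1 : ℤ) ^ (n + 1)) • (f (fun i => a i.castSucc) * a (Fin.last n))

/-- The tuple obtained by multiplying the entries in positions `j` and `j + 1`. -/
def contract {A : Type*} [Mul A] {n : ℕ} (j : ℕ) (a : Fin (n + 1) → A) : Fin n → A :=
  fun m =>
    if (m : ℕ) < j then a m.castSucc
    else if (m : ℕ) = j then a m.castSucc * a m.succ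
    else a m.succ

/-- Like `contract`, but `p = n + 1` multiplies the last entry with the zeroth one. -/
def cyclicContract {A : Type*} [Mul A] {n : ℕ} (p : Fin (n + 2)) (a : Fin (n + 2) → A) :
    Fin (n + 1) → A :=
  if (p : ℕ) = n + 1 then Fin.cons (a (Fin.last (n + 1)) * a 0) fun m => a m.succ.castSucc
  else contract p a

theorem cyclicContract_rotate {A : Type*} [Mul A] {n : ℕ} (a : Fin (n + 2) → A)
    (p i : Fin (n + 2)) (r j : Fin (n + 1))
    (H : ((r : ℕ) ≤ p ∧ (i : ℕ) = r ∧ (i + j : ℕ) = p) ∨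
      ((p : ℕ) < r ∧ (i : ℕ) = r + 1 ∧ (i + j : ℕ) = n + 2 + p) ∨
      ((p : ℕ) = n + 1 ∧ (r : ℕ) = 0 ∧ (i : ℕ) = n + 1 ∧ (j : ℕ) = 0)) :
    (fun m => cyclicContract p a (r + m)) = contract j fun m => a (i + m) := by
  have hp := p.isLt
  have hi := i.isLt
  have hr := r.isLt
  have hj := j.isLt
  funext m
  have hm := m.isLt
  have hv : ((r + m : Fin (n + 1)) : ℕ) =
      if n + 1 ≤ (r + m : ℕ) then (r + m : ℕ) - (n + 1) else r + m := Fin.val_add_eq_ite r m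
  generalize r + m = s at hv
  have hs := s.isLt
  have key : ∀ x y : Fin (n + 2), (x : ℕ) = y → a x = a y := fun x y h => by rw [Fin.ext h]
  unfold cyclicContract
  split_ifs with hpn
  · cases s using Fin.cases with
    | zero =>
      rw [Fin.val_zero] at hv
      unfold contract
      rw [Fin.cons_zero, if_neg (by split_ifs at hv <;> omega),
        if_pos (by split_ifs at hv <;> omega)]
      refine congrArg₂ _ (key _ _ ?_) (key _ _ ?_) <;>
        simp only [Fin.val_add_eq_ite, Fin.val_castSucc, Fin.val_succ, Fin.val_last,
          Fin.val_zero] <;>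
        split_ifs at hv ⊢ <;> omega
    | succ s =>
      rw [Fin.val_succ] at hv
      unfold contract
      rw [Fin.cons_succ]
      split_ifs at hv ⊢ <;> first
        | (exfalso; omega)
        | (refine key _ _ ?_
           simp only [Fin.val_add_eq_ite, Fin.val_castSucc, Fin.val_succ]
           split_ifs <;> omega)
  · unfold contract
    split_ifs at hv ⊢ <;> first
      | (exfalso; omega)
      | (refine key _ _ ?_
         simp only [Fin.val_add_eq_ite, Fin.val_castSucc, Fin.val_succ]
         split_ifs <;> omega)
      | (refine congrArg₂ _ (key _ _ ?_) (key _ _ ?_) <;>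
         simp only [Fin.val_add_eq_ite, Fin.val_castSucc, Fin.val_succ] <;>
         split_ifs <;> omega)

theorem sum_contract_rotate {k A : Type*} [Ring k] [Mul A] {n : ℕ} (F : (Fin (n + 1) → A) → k)
    (a : Fin (n + 2) → A) :
    ∑ i : Fin (n + 2), ∑ j : Fin (n + 1), (-1 : k) ^ ((i : ℕ) * (n + 1) + j) *
        F (contract j fun m => a (i + m))
      = ∑ p : Fin (n + 2), ∑ r : Fin (n + 1), (-1 : k) ^ ((p : ℕ) + r * n) *
        F fun m => cyclicContract p a (r + m) := by
  have hex : ∀ x : Fin (n + 2) × Fin (n + 1), ∃ y : Fin (n + 2) × Fin (n + 1),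
      ((x.2 : ℕ) ≤ x.1 ∧ (y.1 : ℕ) = x.2 ∧ (y.1 + y.2 : ℕ) = x.1) ∨
      ((x.1 : ℕ) < x.2 ∧ (y.1 : ℕ) = x.2 + 1 ∧ (y.1 + y.2 : ℕ) = n + 2 + x.1) ∨
      ((x.1 : ℕ) = n + 1 ∧ (x.2 : ℕ) = 0 ∧ (y.1 : ℕ) = n + 1 ∧ (y.2 : ℕ) = 0) := by
    rintro ⟨⟨p, hp⟩, ⟨r, hr⟩⟩
    by_cases h₁ : p < r
    · exact ⟨(⟨r + 1, by omega⟩, ⟨n + 1 + p - r, by omega⟩), by dsimp only; omega⟩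
    by_cases h₂ : p = n + 1 ∧ r = 0
    · exact ⟨(⟨n + 1, by omega⟩, ⟨0, by omega⟩), by dsimp only; omega⟩
    · exact ⟨(⟨r, by omega⟩, ⟨p - r, by omega⟩), by dsimp only; omega⟩
  choose φ hφ using hex
  have hinj : Function.Injective φ := by
    intro x y hxy
    have hx := hφ x
    have hy := hφ y
    rw [hxy] at hx
    have := x.1.isLt
    have := y.1.isLt
    have := x.2.isLt
    have := y.2.isLt
    have := (φ y).2.isLt
    refine Prod.ext (Fin.ext ?_) (Fin.ext ?_) <;> omega
  rw [← Fintype.sum_prod_type', ← Fintype.sum_prod_type']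
  symm
  refine Fintype.sum_bijective φ (Finite.injective_iff_bijective.mp hinj) _ _ fun x => ?_
  rw [cyclicContract_rotate a x.1 (φ x).1 x.2 (φ x).2 (hφ x)]
  congr 1
  rw [neg_one_pow_eq_pow_mod_two, neg_one_pow_eq_pow_mod_two (n := _ * _ + _)]
  congr 1
  have H := hφ x
  generalize ((φ x).1 : ℕ) = i, ((φ x).2 : ℕ) = j, (x.1 : ℕ) = p, (x.2 : ℕ) = r at H
  change Nat.ModEq 2 _ _
  refine (Nat.modEq_iff_dvd.mpr ?_)
  rcases H with ⟨-, rfl, rfl⟩ | ⟨-, rfl, h⟩ | ⟨rfl, rfl, rfl, rfl⟩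
  · exact ⟨0, by push_cast; ring⟩
  · zify at h
    exact ⟨n + 1, by push_cast; linear_combination h⟩
  · rcases Int.even_mul_succ_self n with ⟨c, hc⟩
    exact ⟨c, by push_cast; linear_combination hc⟩

theorem pairing_hochschildD {k A : Type*} [Field k] [Ring A] [Algebra k A]
    (η : A →ₗ[k] A →ₗ[k] k)
    (hinv : ∀ a b c : A, η (a * b) c = η a (b * c)) (hsym : ∀ a b : A, η a b = η b a)
    {n : ℕ} (g : (Fin n → A) → A) (b : A) (a : Fin (n + 1) → A) :
    η b (hochschildD n g a) = ∑ p : Fin (n + 2), (-1 : k) ^ (p : ℕ) *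
      η (cyclicContract p (Fin.cons b a : Fin (n + 2) → A) 0)
        (g fun j => cyclicContract p (Fin.cons b a : Fin (n + 2) → A) j.succ) := by
  have hlast : η b (g (fun i => a i.castSucc) * a (Fin.last n)) =
      η (a (Fin.last n) * b) (g fun i => a i.castSucc) := by rw [← hinv, hsym, ← hinv]
  rw [Fin.sum_univ_succ, Fin.sum_univ_castSucc, ← add_assoc]
  simp only [hochschildD, map_add, map_sum, map_zsmul, hlast]
  simp only [← hinv, zsmul_eq_mul]
  push_cast
  congr 1
  · congr 1
    · have h : cyclicContract 0 (Fin.cons b a : Fin (n + 2) → A) =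
          Fin.cons (b * a 0) fun i => a i.succ := by
        funext m
        cases m using Fin.cases <;> simp [cyclicContract, contract]
      simp [h]
    · refine Finset.sum_congr rfl fun i _ => ?_
      have h : cyclicContract i.castSucc.succ (Fin.cons b a : Fin (n + 2) → A) =
          Fin.cons b (contract i a) := by
        funext m
        have := i.isLt
        cases m using Fin.cases <;>
          simp [cyclicContract, contract, this.ne]
      rw [h]
      simp [contract]
  · have h : cyclicContract (Fin.last n).succ (Fin.cons b a : Fin (n + 2) → A) =
        Fin.cons (a (Fin.last n) * b) fun i => a i.castSucc := by
      funext m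
      cases m using Fin.cases <;>
        simp [cyclicContract, ← Fin.succ_last]
    simp only [h, Fin.cons_zero, Fin.cons_succ, Fin.val_succ, Fin.val_last]

theorem sum_rotate_pairing_hochschildD {k A : Type*} [Field k] [Ring A] [Algebra k A]
    (η : A →ₗ[k] A →ₗ[k] k)
    (hinv : ∀ a b c : A, η (a * b) c = η a (b * c)) (hsym : ∀ a b : A, η a b = η b a)
    {n : ℕ} (f : (Fin (n + 1) → A) → A) (a : Fin (n + 2) → A) :
    ∑ i : Fin (n + 2), (-1 : k) ^ ((i : ℕ) * (n + 1)) *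
        η 1 (hochschildD (n + 1) f fun j => a (i + j))
      = -∑ i : Fin (n + 2), ∑ j : Fin (n + 1), (-1 : k) ^ ((i : ℕ) * (n + 1) + j) *
        η 1 (f (contract j fun m => a (i + m))) := by
  have hD : ∀ c : Fin (n + 2) → A, η 1 (hochschildD (n + 1) f c) =
      η (c 0) (f fun m => c m.succ)
        - ∑ j : Fin (n + 1), (-1 : k) ^ (j : ℕ) * η 1 (f (contract j c))
        + (-1 : k) ^ n * η (c (Fin.last (n + 1))) (f fun m => c m.castSucc) := by
    intro c
    have hlast : η 1 (f (fun m => c m.castSucc) * c (Fin.last (n + 1))) =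
        η (c (Fin.last (n + 1))) (f fun m => c m.castSucc) := by
      rw [← hinv, hsym, ← hinv, mul_one]
    simp only [hochschildD, map_add, map_sum, map_zsmul, hlast]
    simp only [← hinv, one_mul, zsmul_eq_mul, sub_eq_add_neg, ← Finset.sum_neg_distrib]
    push_cast
    congr 1
    · congr 1
      refine Finset.sum_congr rfl fun j _ => ?_
      rw [pow_succ, mul_neg_one, neg_mul]
      rfl
    · rw [pow_succ, pow_succ, mul_assoc (_ ^ n), neg_one_mul, neg_neg, mul_one]
  have hshift : ∑ i : Fin (n + 2), (-1 : k) ^ ((i : ℕ) * (n + 1)) *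
        ((-1 : k) ^ n * η (a (i + Fin.last (n + 1))) (f fun m => a (i + m.castSucc)))
      = -∑ i : Fin (n + 2), (-1 : k) ^ ((i : ℕ) * (n + 1)) *
        η (a i) (f fun m => a (i + m.succ)) := by
    rw [← Finset.sum_neg_distrib]
    refine (Equiv.sum_comp (Equiv.addRight (1 : Fin (n + 2))) _).symm.trans
      (Finset.sum_congr rfl fun i _ => ?_)
    have h₁ : i + 1 + Fin.last (n + 1) = i := by
      rw [add_assoc, add_comm 1, Fin.last_add_one, add_zero]
    have h₂ : ∀ m : Fin (n + 1), i + 1 + m.castSucc = i + m.succ := fun m => by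
      rw [add_assoc, add_comm 1, Fin.coeSucc_eq_succ]
    simp only [Equiv.coe_addRight, h₁, h₂]
    rw [← mul_assoc, ← pow_add, ← neg_mul]
    congr 1
    rw [Fin.val_add_one]
    split_ifs with h
    · rw [h, Fin.val_last, zero_mul, zero_add, add_one_mul, ← add_assoc, pow_succ, pow_add,
        (Nat.even_mul_succ_self n).neg_one_pow, one_mul, mul_neg_one, neg_neg]
    · rw [add_one_mul, add_assoc, pow_add,
        (show Odd (n + 1 + n) from ⟨n, by ring⟩).neg_one_pow, mul_neg_one]
  simp only [hD, mul_add, mul_sub, Finset.sum_add_distrib, Finset.sum_sub_distrib, add_zero]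
  simp only [mul_add] at hshift
  rw [hshift, sub_add_eq_add_sub, add_neg_cancel, zero_sub, neg_inj]
  simp only [pow_add, Finset.mul_sum, mul_assoc]

/-- Let `A` be a Frobenius algebra over a field `k`, `∂` the Hochschild coboundary, and `Δ`
the Connes-type operator on normalized Hochschild cochains, defined implicitly by
`η(a₀, (Δf)(a₁,…,a_{n−1})) = η(1, f(N(a₀ ⊗ ⋯ ⊗ a_{n−1})))` where `N = 1 + t + ⋯ + t^{n−1}`
is the signed norm operator.  If `g` satisfies the defining relation of `Δf` and `h` that of
`Δ(∂f)`, with `f` a normalized cochain, then `Δ∂ + ∂Δ = 0`, i.e. `h + ∂g = 0`. -/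
theorem stmt11 {k A : Type*} [Field k] [Ring A] [Algebra k A] [FiniteDimensional k A]
    (η : A →ₗ[k] A →ₗ[k] k)
    (hnd : ∀ a : A, (∀ b : A, η a b = 0) → a = 0)
    (hinv : ∀ a b c : A, η (a * b) c = η a (b * c))
    (hsym : ∀ a b : A, η a b = η b a)
    (n : ℕ)
    (f : (Fin (n + 1) → A) → A)
    (hf : ∀ a : Fin (n + 1) → A, (∃ i, a i = 1) → f a = 0)
    (g : (Fin n → A) → A)
    (hg : ∀ a : Fin (n + 1) → A,
      η (a 0) (g (fun j : Fin n => a j.succ))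
        = ∑ i : Fin (n + 1), ((-1 : k) ^ ((i : ℕ) * n)) *
            η 1 (f (fun j : Fin (n + 1) => a (i + j))))
    (h : (Fin (n + 1) → A) → A)
    (hh : ∀ a : Fin (n + 2) → A,
      η (a 0) (h (fun j : Fin (n + 1) => a j.succ))
        = ∑ i : Fin (n + 2), ((-1 : k) ^ ((i : ℕ) * (n + 1))) *
            η 1 (hochschildD (n + 1) f (fun j : Fin (n + 2) => a (i + j)))) :
    ∀ a : Fin (n + 1) → A, h a + hochschildD n g a = 0 := by
  intro a
  refine hnd _ fun b => ?_
  rw [hsym, map_add, pairing_hochschildD η hinv hsym g b a]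
  have hb := hh (Fin.cons b a)
  simp only [Fin.cons_zero, Fin.cons_succ] at hb
  rw [hb, sum_rotate_pairing_hochschildD η hinv hsym f, neg_add_eq_zero,
    sum_contract_rotate fun c => η 1 (f c)]
  refine Finset.sum_congr rfl fun p _ => ?_
  rw [hg, Finset.mul_sum]
  exact Finset.sum_congr rfl fun r _ => by rw [pow_add, mul_assoc]
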